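/- arXiv:2003.03627 — 4 statements merged into one kernel-verified Lean document; each statement's English description precedes it below -/
import Mathlib

section
/- Let φ(x) = 1/(1 + e^{−x}) be the logistic function and, for ξ ≠ 0, let ℓ(ξ) = (1/2 − φ(ξ))/(2ξ). Then for every s ∈ ℝ and every ξ ≠ 0, φ(s) ≥ φ(ξ) · exp((s − ξ)/2 + ℓ(ξ)(s² − ξ²)). Moreover, equality holds when s = ξ and when s = −ξ. -/
/-- The logistic (sigmoid) function `φ(x) = 1 / (1 + e^{-x})`. -/
noncomputable def phi (x : ℝ) : ℝ := 1 / (1 + Real.exp (-x))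

/-- The variational coefficient `ℓ(ξ) = (1/2 - φ(ξ)) / (2ξ)`. -/
noncomputable def ell (ξ : ℝ) : ℝ := (1 / 2 - phi ξ) / (2 * ξ)

lemma jj_sinh {u v : ℝ} (hu : 0 ≤ u) (huv : u ≤ v) :
    v * Real.sinh u ≤ u * Real.sinh v := by
  have hd : ∀ x : ℝ, HasDerivAt (fun x => u * Real.sinh x - x * Real.sinh u)
      (u * Real.cosh x - 1 * Real.sinh u) x := fun x =>
    ((Real.hasDerivAt_sinh x).const_mul u).sub ((hasDerivAt_id x).mul_const _)
  -- sinh u ≤ u cosh u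
  have h1 : Real.sinh u ≤ u * Real.cosh u := by
    have hd2 : ∀ x : ℝ, HasDerivAt (fun x => x * Real.cosh x - Real.sinh x)
        (1 * Real.cosh x + x * Real.sinh x - Real.cosh x) x := fun x =>
      ((hasDerivAt_id x).mul (Real.hasDerivAt_cosh x)).sub (Real.hasDerivAt_sinh x)
    have hm : MonotoneOn (fun x => x * Real.cosh x - Real.sinh x) (Set.Ici 0) := by
      apply monotoneOn_of_deriv_nonneg (convex_Ici 0)
      · exact fun x _ => (hd2 x).continuousAt.continuousWithinAt
      · exact fun x _ => (hd2 x).differentiableAt.differentiableWithinAt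
      · intro x hx
        rw [interior_Ici] at hx
        have hx : 0 < x := hx
        rw [(hd2 x).deriv]
        have := mul_pos hx (Real.sinh_pos_iff.2 hx)
        linarith
    have := hm (Set.mem_Ici.2 le_rfl) (Set.mem_Ici.2 hu) hu
    simp at this
    linarith
  have hm : MonotoneOn (fun x => u * Real.sinh x - x * Real.sinh u) (Set.Ici u) := by
    apply monotoneOn_of_deriv_nonneg (convex_Ici u)
    · exact fun x _ => (hd x).continuousAt.continuousWithinAt
    · exact fun x _ => (hd x).differentiableAt.differentiableWithinAt
    · intro x hx
      rw [interior_Ici] at hx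
      have hx : u < x := hx
      rw [(hd x).deriv]
      have hc : Real.cosh u ≤ Real.cosh x := by
        rw [Real.cosh_le_cosh, abs_of_nonneg hu, abs_of_nonneg (hu.trans hx.le)]
        exact hx.le
      have := mul_le_mul_of_nonneg_left hc hu
      linarith
  have := hm (Set.mem_Ici.2 le_rfl) (Set.mem_Ici.2 huv) huv
  simp only at this
  linarith

lemma jj_tanh {a b : ℝ} (ha : 0 ≤ a) (hab : a ≤ b) :
    a * Real.cosh a * Real.sinh b ≤ b * Real.cosh b * Real.sinh a := by
  have h := jj_sinh (u := b - a) (v := a + b) (by linarith) (by linarith)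
  rw [Real.sinh_sub, Real.sinh_add] at h
  nlinarith

lemma jj_cosh_pos {a b : ℝ} (ha : 0 ≤ a) (hb : 0 < b) :
    Real.cosh a * Real.exp (-(Real.sinh b / (2 * b * Real.cosh b)) * a ^ 2)
      ≤ Real.cosh b * Real.exp (-(Real.sinh b / (2 * b * Real.cosh b)) * b ^ 2) := by
  set c := Real.sinh b / (2 * b * Real.cosh b) with hc
  have hcb := Real.cosh_pos b
  have hc' : 2 * c * (b * Real.cosh b) = Real.sinh b := by rw [hc]; field_simp
  have hbc : 0 < b * Real.cosh b := mul_pos hb hcb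
  have hd : ∀ x : ℝ, HasDerivAt (fun x => Real.cosh x * Real.exp (-c * x ^ 2))
      ((Real.sinh x - 2 * c * (x * Real.cosh x)) * Real.exp (-c * x ^ 2)) x := fun x => by
    have := (Real.hasDerivAt_cosh x).mul (((hasDerivAt_pow 2 x).const_mul (-c)).exp)
    refine this.congr_deriv ?_
    push_cast
    ring
  rcases le_total a b with hab | hab
  · have hm : MonotoneOn (fun x => Real.cosh x * Real.exp (-c * x ^ 2)) (Set.Icc 0 b) := by
      apply monotoneOn_of_deriv_nonneg (convex_Icc 0 b)
      · exact fun x _ => (hd x).continuousAt.continuousWithinAt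
      · exact fun x _ => (hd x).differentiableAt.differentiableWithinAt
      · intro x hx
        rw [interior_Icc] at hx
        rw [(hd x).deriv]
        refine mul_nonneg ?_ (Real.exp_pos _).le
        have := jj_tanh hx.1.le hx.2.le
        rw [← hc'] at this
        have : (b * Real.cosh b) * (2 * c * (x * Real.cosh x)) ≤ (b * Real.cosh b) * Real.sinh x := by
          linarith
        have := le_of_mul_le_mul_left this hbc
        linarith
    exact hm ⟨ha, hab⟩ ⟨hb.le, le_rfl⟩ hab
  · have hm : AntitoneOn (fun x => Real.cosh x * Real.exp (-c * x ^ 2)) (Set.Ici b) := by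
      apply antitoneOn_of_deriv_nonpos (convex_Ici b)
      · exact fun x _ => (hd x).continuousAt.continuousWithinAt
      · exact fun x _ => (hd x).differentiableAt.differentiableWithinAt
      · intro x hx
        rw [interior_Ici] at hx
        have hx : b < x := hx
        rw [(hd x).deriv]
        refine mul_nonpos_of_nonpos_of_nonneg ?_ (Real.exp_pos _).le
        have := jj_tanh hb.le hx.le
        rw [← hc'] at this
        have : (b * Real.cosh b) * Real.sinh x ≤ (b * Real.cosh b) * (2 * c * (x * Real.cosh x)) := by
          linarith
        have := le_of_mul_le_mul_left this hbc
        linarith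
    exact hm (Set.mem_Ici.2 le_rfl) (Set.mem_Ici.2 hab) hab

lemma jj_cosh (a : ℝ) {b : ℝ} (hb : b ≠ 0) :
    Real.cosh a * Real.exp (-(Real.sinh b / (2 * b * Real.cosh b)) * a ^ 2)
      ≤ Real.cosh b * Real.exp (-(Real.sinh b / (2 * b * Real.cosh b)) * b ^ 2) := by
  have h := jj_cosh_pos (abs_nonneg a) (abs_pos.2 hb)
  rw [Real.cosh_abs, Real.cosh_abs, sq_abs, sq_abs] at h
  rcases abs_choice b with hb' | hb' <;> rw [hb'] at h
  · exact h
  · rw [Real.sinh_neg, show -Real.sinh b / (2 * -b * Real.cosh b)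
      = Real.sinh b / (2 * b * Real.cosh b) by
        rw [show 2 * -b * Real.cosh b = -(2 * b * Real.cosh b) by ring, neg_div_neg_eq]] at h
    exact h

lemma jj_phi (x : ℝ) : phi x = Real.exp (x / 2) / (2 * Real.cosh (x / 2)) := by
  unfold phi
  rw [Real.cosh_eq, show -x = -(x / 2) + -(x / 2) by ring, Real.exp_add]
  have h : Real.exp (x / 2) * Real.exp (-(x / 2)) = 1 := by
    rw [← Real.exp_add]; simp
  have h1 := Real.exp_pos (x / 2)
  have h2 := Real.exp_pos (-(x / 2))
  rw [div_eq_div_iff (by positivity) (by positivity)]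
  linear_combination (-Real.exp (-(x / 2))) * h

lemma jj_ell (ξ : ℝ) (hξ : ξ ≠ 0) : ell ξ * 4 =
    -(Real.sinh (ξ / 2) / (2 * (ξ / 2) * Real.cosh (ξ / 2))) := by
  unfold ell
  rw [jj_phi]
  have hc := (Real.cosh_pos (ξ / 2)).ne'
  rw [← Real.cosh_add_sinh (ξ / 2)]
  field_simp
  ring

/-- **Jaakkola–Jordan variational lower bound on the logistic likelihood (eq. (12)).**
For every `s` and every `ξ ≠ 0`,
`φ(s) ≥ φ(ξ) · exp((s - ξ)/2 + ℓ(ξ)(s² - ξ²))`,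
with equality when `s = ξ` and when `s = -ξ`. -/
theorem logistic_variational_lower_bound (s ξ : ℝ) (hξ : ξ ≠ 0) :
    phi s ≥ phi ξ * Real.exp ((s - ξ) / 2 + ell ξ * (s ^ 2 - ξ ^ 2))
      ∧ phi ξ = phi ξ * Real.exp ((ξ - ξ) / 2 + ell ξ * (ξ ^ 2 - ξ ^ 2))
      ∧ phi (-ξ) = phi ξ * Real.exp (((-ξ) - ξ) / 2 + ell ξ * ((-ξ) ^ 2 - ξ ^ 2)) := by
  refine ⟨?_, by simp, ?_⟩
  · have h := jj_cosh (s / 2) (b := ξ / 2) (by simpa using hξ)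
    rw [← jj_ell ξ hξ, show ell ξ * 4 * (s / 2) ^ 2 = ell ξ * (s ^ 2 - ξ ^ 2) + ell ξ * ξ ^ 2 by ring,
      show ell ξ * 4 * (ξ / 2) ^ 2 = ell ξ * ξ ^ 2 by ring, Real.exp_add, ← mul_assoc] at h
    have h := le_of_mul_le_mul_right h (Real.exp_pos _)
    have hs := Real.cosh_pos (s / 2)
    have hx := Real.cosh_pos (ξ / 2)
    rw [jj_phi, jj_phi, ge_iff_le, div_mul_eq_mul_div, Real.exp_add, ← mul_assoc, ← Real.exp_add,
      show ξ / 2 + (s - ξ) / 2 = s / 2 by ring, div_le_div_iff₀ (by positivity) (by positivity)]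
    have := mul_le_mul_of_nonneg_left h (Real.exp_pos (s / 2)).le
    linarith
  · rw [jj_phi, jj_phi, neg_div, Real.cosh_neg, div_mul_eq_mul_div, ← Real.exp_add]
    congr 2
    ring
end

section
/- Let φ(x) = 1/(1 + e^{−x}) be the logistic function and, for ξ ≠ 0, let ℓ(ξ) = (1/2 − φ(ξ))/(2ξ). Then for every s ≠ 0, the supremum over ξ ≠ 0 of φ(ξ) · exp((s − ξ)/2 + ℓ(ξ)(s² − ξ²)) equals φ(s), and this supremum is attained at ξ = s. -/
lemma aux_sinh {x y : ℝ} (hx : 0 ≤ x) (hxy : x ≤ y) : y * Real.sinh x ≤ x * Real.sinh y := by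
  have hc : ConvexOn ℝ (Set.Ici (0:ℝ)) Real.sinh := by
    apply MonotoneOn.convexOn_of_deriv (convex_Ici 0) Real.continuous_sinh.continuousOn
      Real.differentiable_sinh.differentiableOn
    rw [Real.deriv_sinh, interior_Ici]
    intro u hu v hv huv
    rw [Real.cosh_le_cosh, abs_of_pos hu, abs_of_pos hv]
    exact huv
  rcases eq_or_lt_of_le (hx.trans hxy) with h | h
  · have : x = 0 := by linarith
    subst this; simp [← h]
  · have e1 : 0 ≤ 1 - x / y := by rw [sub_nonneg, div_le_one h]; exact hxy
    have e2 : 0 ≤ x / y := by positivity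
    have h1 := hc.2 (Set.mem_Ici.2 le_rfl) (Set.mem_Ici.2 h.le) e1 e2 (by ring)
    simp only [smul_eq_mul, mul_zero, Real.sinh_zero, zero_add] at h1
    rw [div_mul_cancel₀ _ h.ne', div_mul_eq_mul_div, le_div_iff₀ h] at h1
    linarith

lemma aux_tanh {x y : ℝ} (hx : 0 ≤ x) (hxy : x ≤ y) :
    x * (Real.sinh y * Real.cosh x) ≤ y * (Real.sinh x * Real.cosh y) := by
  have h := aux_sinh (x := y - x) (y := y + x) (by linarith) (by linarith)
  rw [Real.sinh_add, Real.sinh_sub] at h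
  linarith

lemma aux_log {a b : ℝ} (ha : 0 < a) (hb : 0 ≤ b) :
    Real.log (Real.cosh b) - Real.sinh a / Real.cosh a / (2 * a) * b ^ 2 ≤
      Real.log (Real.cosh a) - Real.sinh a / Real.cosh a / (2 * a) * a ^ 2 := by
  set g : ℝ → ℝ := fun t => Real.log (Real.cosh t) -
    Real.sinh a / Real.cosh a / (2 * a) * t ^ 2 with hg
  have hd : ∀ t, HasDerivAt g ((a * (Real.sinh t * Real.cosh a) -
      t * (Real.sinh a * Real.cosh t)) / (a * Real.cosh a * Real.cosh t)) t := by
    intro t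
    have h1 := (Real.hasDerivAt_cosh t).log (Real.cosh_pos t).ne'
    have h2 := (hasDerivAt_pow 2 t).const_mul (Real.sinh a / Real.cosh a / (2 * a))
    refine (h1.sub h2).congr_deriv ?_
    have := (Real.cosh_pos t).ne'
    have := (Real.cosh_pos a).ne'
    field_simp
    simp
    try ring
  have hcont : Continuous g := continuous_iff_continuousAt.2 fun t => (hd t).continuousAt
  have hpos : ∀ t, 0 ≤ a * Real.cosh a * Real.cosh t := fun t => by
    have := Real.cosh_pos t
    have := Real.cosh_pos a
    positivity
  change g b ≤ g a
  rcases le_total b a with h | h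
  · refine monotoneOn_of_deriv_nonneg (convex_Icc 0 a) hcont.continuousOn
      (fun t _ => (hd t).differentiableAt.differentiableWithinAt) ?_ ⟨hb, h⟩ ⟨ha.le, le_rfl⟩ h
    intro t ht
    rw [interior_Icc] at ht
    rw [(hd t).deriv]
    exact div_nonneg (sub_nonneg.2 (aux_tanh ht.1.le ht.2.le)) (hpos t)
  · refine antitoneOn_of_deriv_nonpos (convex_Ici a) hcont.continuousOn
      (fun t _ => (hd t).differentiableAt.differentiableWithinAt) ?_
      (Set.mem_Ici.2 le_rfl) (Set.mem_Ici.2 h) h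
    intro t ht
    rw [interior_Ici] at ht
    rw [(hd t).deriv]
    exact div_nonpos_of_nonpos_of_nonneg (sub_nonpos.2 (aux_tanh ha.le (le_of_lt ht))) (hpos t)

lemma aux_log' {a : ℝ} (b : ℝ) (ha : a ≠ 0) :
    Real.log (Real.cosh b) - Real.sinh a / Real.cosh a / (2 * a) * b ^ 2 ≤
      Real.log (Real.cosh a) - Real.sinh a / Real.cosh a / (2 * a) * a ^ 2 := by
  have h := aux_log (abs_pos.2 ha) (abs_nonneg b)
  rw [Real.cosh_abs, Real.cosh_abs, sq_abs, sq_abs] at h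
  rcases abs_cases a with ⟨h1, _⟩ | ⟨h1, _⟩
  · rwa [h1] at h
  · rw [h1, Real.sinh_neg, neg_div, mul_neg, neg_div_neg_eq] at h
    exact h

lemma phi_eq (x : ℝ) : phi x = Real.exp (x / 2 - Real.log (Real.cosh (x / 2))) / 2 := by
  rw [Real.exp_sub, Real.exp_log (Real.cosh_pos _), Real.cosh_eq, phi]
  have h : Real.exp (-x) = Real.exp (-(x/2)) * Real.exp (-(x/2)) := by
    rw [← Real.exp_add]; ring_nf
  rw [h, Real.exp_neg]
  have := Real.exp_pos (x / 2)
  field_simp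

lemma ell_eq (x : ℝ) :
    ell x = - (Real.sinh (x / 2) / Real.cosh (x / 2) / (2 * (x / 2))) / 4 := by
  have h : 1 / 2 - phi x = - (Real.sinh (x / 2) / Real.cosh (x / 2)) / 2 := by
    rw [Real.cosh_eq, Real.sinh_eq, phi]
    have h : Real.exp (-x) = Real.exp (-(x/2)) * Real.exp (-(x/2)) := by
      rw [← Real.exp_add]; ring_nf
    rw [h, Real.exp_neg]
    have := Real.exp_pos (x / 2)
    field_simp
    ring
  rw [ell, h]
  ring

/-- **Tightness of the variational lower bound.**  For every `s ≠ 0`, the supremum over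
`ξ ≠ 0` of `φ(ξ) · exp((s - ξ)/2 + ℓ(ξ)(s² - ξ²))` equals `φ(s)` (it is the greatest
element of the set of values), and it is attained at `ξ = s`. -/
theorem variational_bound_tight (s : ℝ) (hs : s ≠ 0) :
    IsGreatest
      ((fun ξ : ℝ => phi ξ * Real.exp ((s - ξ) / 2 + ell ξ * (s ^ 2 - ξ ^ 2))) ''
        {ξ : ℝ | ξ ≠ 0})
      (phi s)
      ∧ phi s * Real.exp ((s - s) / 2 + ell s * (s ^ 2 - s ^ 2)) = phi s := by
  have key : phi s * Real.exp ((s - s) / 2 + ell s * (s ^ 2 - s ^ 2)) = phi s := by simp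
  refine ⟨⟨⟨s, hs, key⟩, ?_⟩, key⟩
  rintro _ ⟨ξ, hξ, rfl⟩
  have hξ' : ξ / 2 ≠ 0 := div_ne_zero hξ two_ne_zero
  have h := aux_log' (s / 2) hξ'
  simp only
  rw [ell_eq, phi_eq, phi_eq, div_mul_eq_mul_div, ← Real.exp_add]
  generalize Real.sinh (ξ / 2) / Real.cosh (ξ / 2) / (2 * (ξ / 2)) = k at h ⊢
  have : ∀ u v : ℝ, u ≤ v → Real.exp u / 2 ≤ Real.exp v / 2 := fun u v huv => by gcongr
  apply this
  linarith
end

section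
/- The function x ↦ −log(2·cosh(√x / 2)) is convex on the interval (0, ∞). Equivalently, with φ(x) = 1/(1 + e^{−x}) the logistic function, x ↦ log φ(√x) − √x/2 is convex on (0, ∞). -/
lemma g_anti : AntitoneOn (fun u : ℝ => Real.sinh u / (u * Real.cosh u)) (Set.Ioi 0) := by
  have hd : ∀ u ∈ Set.Ioi (0:ℝ), HasDerivAt (fun u : ℝ => Real.sinh u / (u * Real.cosh u))
      ((Real.cosh u * (u * Real.cosh u) - Real.sinh u * (1 * Real.cosh u + u * Real.sinh u))
        / (u * Real.cosh u) ^ 2) u := by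
    intro u hu
    have hu' : (0:ℝ) < u := hu
    exact (Real.hasDerivAt_sinh u).div ((hasDerivAt_id' u).mul (Real.hasDerivAt_cosh u))
      (mul_pos hu' (Real.cosh_pos u)).ne'
  apply antitoneOn_of_deriv_nonpos (convex_Ioi 0)
  · exact fun u hu => (hd u hu).continuousAt.continuousWithinAt
  · rw [interior_Ioi]
    exact fun u hu => (hd u hu).differentiableAt.differentiableWithinAt
  · rw [interior_Ioi]
    intro u hu
    rw [(hd u hu).deriv]
    have hu' : (0:ℝ) < u := hu
    apply div_nonpos_of_nonpos_of_nonneg _ (sq_nonneg _)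
    have h1 := Real.self_le_sinh_iff.2 hu'.le
    have h2 := Real.one_le_cosh u
    have h3 := Real.cosh_sq u
    nlinarith [mul_nonneg (hu'.le.trans h1) (sub_nonneg.2 h2)]

lemma first_convex : ConvexOn ℝ (Set.Ioi (0 : ℝ))
    (fun x : ℝ => -Real.log (2 * Real.cosh (Real.sqrt x / 2))) := by
  have hd : ∀ x ∈ Set.Ioi (0:ℝ),
      HasDerivAt (fun x : ℝ => -Real.log (2 * Real.cosh (Real.sqrt x / 2)))
      (-(1/8) * (Real.sinh (√x / 2) / ((√x / 2) * Real.cosh (√x / 2)))) x := by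
    intro x hx
    have hx' : (0:ℝ) < x := hx
    have hs := Real.sqrt_pos.2 hx'
    have hc := Real.cosh_pos (√x / 2)
    have h := ((((Real.hasDerivAt_sqrt hx'.ne').div_const 2).cosh.const_mul 2).log
      (by positivity)).neg
    refine HasDerivAt.congr_deriv h ?_
    field_simp
    try norm_num
  apply MonotoneOn.convexOn_of_deriv (convex_Ioi 0)
  · exact fun u hu => (hd u hu).continuousAt.continuousWithinAt
  · rw [interior_Ioi]
    exact fun u hu => (hd u hu).differentiableAt.differentiableWithinAt
  · rw [interior_Ioi]
    intro x hx y hy hxy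
    rw [(hd x hx).deriv, (hd y hy).deriv]
    have h := g_anti (a := √x / 2) (b := √y / 2) (half_pos (Real.sqrt_pos.2 hx))
      (half_pos (Real.sqrt_pos.2 hy))
      (div_le_div_of_nonneg_right (Real.sqrt_le_sqrt hxy) (by norm_num))
    simp only at h
    linarith

lemma log_phi_eq (s : ℝ) : Real.log (phi s) - s / 2 = -Real.log (2 * Real.cosh (s / 2)) := by
  have h : 2 * Real.cosh (s / 2) = Real.exp (s / 2) * (1 + Real.exp (-s)) := by
    rw [Real.cosh_eq, mul_add, ← Real.exp_add, show s / 2 + -s = -(s / 2) by ring]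
    ring
  rw [h, Real.log_mul (Real.exp_pos _).ne' (by positivity), Real.log_exp, phi, one_div,
    Real.log_inv]
  ring

/-- The function `x ↦ -log(2 cosh(√x / 2))` is convex on `(0, ∞)`; equivalently,
`x ↦ log φ(√x) - √x / 2` is convex on `(0, ∞)`. -/
theorem convexity_in_squared_argument :
    ConvexOn ℝ (Set.Ioi (0 : ℝ))
        (fun x : ℝ => -Real.log (2 * Real.cosh (Real.sqrt x / 2)))
      ∧ ConvexOn ℝ (Set.Ioi (0 : ℝ))
        (fun x : ℝ => Real.log (phi (Real.sqrt x)) - Real.sqrt x / 2) := by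
  refine ⟨first_convex, ?_⟩
  simp only [log_phi_eq]
  exact first_convex
end

section
/- Let φ(x) = 1/(1 + e^{−x}) be the logistic function and, for ξ ≠ 0, let ℓ(ξ) = (1/2 − φ(ξ))/(2ξ). Fix v > 0 and define F(ξ) = log φ(ξ) − ξ/2 + ℓ(ξ)(v − ξ²) for ξ > 0. Then F attains its maximum over (0, ∞) at ξ = √v; that is, F(ξ) ≤ F(√v) for all ξ > 0. -/
theorem hasDerivAt_phi (x : ℝ) :
    HasDerivAt phi (Real.exp (-x) / (1 + Real.exp (-x)) ^ 2) x := by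
  have hp := Real.exp_pos (-x)
  have h1 : HasDerivAt (fun y : ℝ => 1 + Real.exp (-y)) (Real.exp (-x) * (-1)) x :=
    ((hasDerivAt_neg x).exp).const_add 1
  have h2 := (hasDerivAt_const x (1 : ℝ)).div h1 (by positivity)
  refine HasDerivAt.congr_deriv (f := phi) h2 ?_
  ring

theorem phi_pos (x : ℝ) : 0 < phi x := by
  unfold phi
  have hp := Real.exp_pos (-x)
  positivity

theorem hasDerivAt_ell (x : ℝ) (hx : 0 < x) :
    HasDerivAt ell ((-(Real.exp (-x) / (1 + Real.exp (-x)) ^ 2) * (2 * x)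
      - (1 / 2 - phi x) * 2) / (2 * x) ^ 2) x := by
  have h1 := (hasDerivAt_phi x).const_sub (1 / 2)
  have h2 : HasDerivAt (fun y : ℝ => 2 * y) 2 x := by
    simpa using (hasDerivAt_id x).const_mul 2
  exact h1.div h2 (by positivity)

theorem ell_monotoneOn : MonotoneOn ell (Set.Ioi 0) := by
  refine monotoneOn_of_deriv_nonneg (convex_Ioi 0)
    (fun x hx => (hasDerivAt_ell x hx).continuousAt.continuousWithinAt)
    (fun x hx => ?_) (fun x hx => ?_)
  · rw [interior_Ioi] at hx
    exact (hasDerivAt_ell x hx).differentiableAt.differentiableWithinAt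
  · rw [interior_Ioi] at hx
    have hx0 : 0 < x := hx
    rw [(hasDerivAt_ell x hx0).deriv]
    apply div_nonneg _ (by positivity)
    have hs := Real.self_le_sinh_iff.2 hx0.le
    rw [Real.sinh_eq] at hs
    have hp := Real.exp_pos (-x)
    have hm : Real.exp x * Real.exp (-x) = 1 := by rw [← Real.exp_add]; simp
    unfold phi
    set E := Real.exp (-x)
    have h3 : 2 * x * E ≤ 1 - E ^ 2 := by nlinarith
    have h4 : -(E / (1 + E) ^ 2) * (2 * x) - (1 / 2 - 1 / (1 + E)) * 2
        = (1 - E ^ 2 - 2 * x * E) / (1 + E) ^ 2 := by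
      field_simp
      ring
    rw [h4]
    exact div_nonneg (by linarith) (by positivity)

theorem hasDerivAt_gap (a x : ℝ) (hx : 0 < x) :
    HasDerivAt (fun t => Real.log (phi t) - t / 2 - ell a * (t ^ 2 - a ^ 2))
      (2 * x * (ell x - ell a)) x := by
  have h1 := (hasDerivAt_phi x).log (phi_pos x).ne'
  have h2 := (hasDerivAt_id x).div_const 2
  have h3 := (((hasDerivAt_pow 2 x).sub_const (a ^ 2)).const_mul (ell a))
  refine ((h1.sub h2).sub h3).congr_deriv ?_
  have h5 : 2 * x * ell x = 1 / 2 - phi x := by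
    unfold ell
    field_simp
  have hp := Real.exp_pos (-x)
  have h6 : Real.exp (-x) / (1 + Real.exp (-x)) ^ 2 / phi x = 1 - phi x := by
    unfold phi
    field_simp
    ring
  rw [h6, mul_sub, h5]
  push_cast
  ring

/-- **Optimality of the variational-parameter update (eq. (15)).**
Fix `v > 0` and let `F(ξ) = log φ(ξ) - ξ/2 + ℓ(ξ)(v - ξ²)` for `ξ > 0`.
Then `F` attains its maximum over `(0, ∞)` at `ξ = √v`. -/
theorem variational_parameter_optimal (v : ℝ) (hv : 0 < v) :
    ∀ ξ : ℝ, 0 < ξ →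
      Real.log (phi ξ) - ξ / 2 + ell ξ * (v - ξ ^ 2)
        ≤ Real.log (phi (Real.sqrt v)) - Real.sqrt v / 2
            + ell (Real.sqrt v) * (v - Real.sqrt v ^ 2) := by
  intro ξ hξ
  have ht : 0 < Real.sqrt v := Real.sqrt_pos.2 hv
  have hsq : Real.sqrt v ^ 2 = v := Real.sq_sqrt hv.le
  generalize Real.sqrt v = t at ht hsq
  subst hsq
  suffices h : (fun t => Real.log (phi t) - t / 2 - ell ξ * (t ^ 2 - ξ ^ 2)) ξ ≤
      (fun t => Real.log (phi t) - t / 2 - ell ξ * (t ^ 2 - ξ ^ 2)) t by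
    simp only [sub_self, mul_zero] at h ⊢
    linarith
  rcases le_total ξ t with hle | hle
  · refine monotoneOn_of_deriv_nonneg (convex_Icc ξ t)
      (fun x hx => (hasDerivAt_gap ξ x (hξ.trans_le hx.1)).continuousAt.continuousWithinAt)
      (fun x hx => ?_) (fun x hx => ?_) (Set.left_mem_Icc.2 hle) (Set.right_mem_Icc.2 hle) hle
    all_goals
      rw [interior_Icc] at hx
      have hx0 : 0 < x := hξ.trans hx.1
    · exact (hasDerivAt_gap ξ x hx0).differentiableAt.differentiableWithinAt
    · rw [(hasDerivAt_gap ξ x hx0).deriv]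
      have := ell_monotoneOn hξ hx0 hx.1.le
      exact mul_nonneg (by positivity) (by linarith)
  · refine antitoneOn_of_deriv_nonpos (convex_Icc t ξ)
      (fun x hx => (hasDerivAt_gap ξ x (ht.trans_le hx.1)).continuousAt.continuousWithinAt)
      (fun x hx => ?_) (fun x hx => ?_) (Set.left_mem_Icc.2 hle) (Set.right_mem_Icc.2 hle) hle
    all_goals
      rw [interior_Icc] at hx
      have hx0 : 0 < x := ht.trans hx.1
    · exact (hasDerivAt_gap ξ x hx0).differentiableAt.differentiableWithinAt
    · rw [(hasDerivAt_gap ξ x hx0).deriv]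
      have := ell_monotoneOn hx0 hξ hx.2.le
      exact mul_nonpos_of_nonneg_of_nonpos (by positivity) (by linarith)
end
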